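/- Let a ≥ 0 and b > 0 with a ≠ b and a > 0, and let x_1, x_2 be i.i.d. random variables uniformly distributed on [−a, b]. Then E[ log|1 + x_2/x_1| ] = 2 (a² + b²)/(a+b)² · log 2 − 1/2 + ((a − b)/(a+b)²) · ( b log|1 − a/b| − a log|1 − b/a| ). -/

import Mathlib

open MeasureTheory ProbabilityTheory

lemma integral_mul_log (c d : ℝ) :
    ∫ t in c..d, t * Real.log t =
      (d * (d * Real.log d) / 2 - d ^ 2 / 4) - (c * (c * Real.log c) / 2 - c ^ 2 / 4) := by
  refine integral_eq_of_hasDerivAt_off_countable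
    (fun t => t * (t * Real.log t) / 2 - t ^ 2 / 4) (fun t => t * Real.log t)
    (Set.countable_singleton 0) ?_ ?_ (Real.continuous_mul_log.intervalIntegrable _ _)
  · have h := Real.continuous_mul_log
    exact (((continuous_id.mul h).div_const 2).sub (by fun_prop)).continuousOn
  · rintro x ⟨-, hx⟩
    have hx : x ≠ 0 := hx
    have h := ((((hasDerivAt_id x).mul
      ((hasDerivAt_id x).mul (Real.hasDerivAt_log hx))).div_const 2).sub
      (((hasDerivAt_id x).pow 2).div_const 4))
    convert! h using 1
    simp
    field_simp
    ring

lemma integrable_log_add_prod {c d : ℝ} (hcd : c ≤ d) :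
    Integrable (fun z : ℝ × ℝ => Real.log (z.1 + z.2))
      ((volume.restrict (Set.Ioc c d)).prod (volume.restrict (Set.Ioc c d))) := by
  have hm : Measurable (fun z : ℝ × ℝ => Real.log (z.1 + z.2)) := by fun_prop
  rw [integrable_prod_iff hm.aestronglyMeasurable]
  constructor
  · refine Filter.Eventually.of_forall fun x => ?_
    have h := (intervalIntegral.intervalIntegrable_log' (a := x + c) (b := x + d)).comp_add_left x
    simp only [add_sub_cancel_left] at h
    exact (intervalIntegrable_iff_integrableOn_Ioc_of_le hcd).1 h
  · have hint : ∀ p q : ℝ, IntervalIntegrable (fun t => ‖Real.log t‖) volume p q :=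
      fun p q => intervalIntegral.intervalIntegrable_log'.norm
    have hcont := intervalIntegral.continuous_primitive hint 0
    have heq : (fun x => ∫ y in Set.Ioc c d, ‖Real.log (x + y)‖) =
        fun x => (∫ t in (0 : ℝ)..(x + d), ‖Real.log t‖) -
          ∫ t in (0 : ℝ)..(x + c), ‖Real.log t‖ := by
      funext x
      rw [← intervalIntegral.integral_of_le hcd,
        intervalIntegral.integral_comp_add_left (fun t => ‖Real.log t‖) x,
        intervalIntegral.integral_interval_sub_left (hint _ _) (hint _ _)]
    simp only [heq]
    have hc : Continuous fun x => (∫ t in (0 : ℝ)..(x + d), ‖Real.log t‖) -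
          ∫ t in (0 : ℝ)..(x + c), ‖Real.log t‖ :=
      (hcont.comp (continuous_id.add continuous_const)).sub
        (hcont.comp (continuous_id.add continuous_const))
    exact (intervalIntegrable_iff_integrableOn_Ioc_of_le hcd).1 (hc.intervalIntegrable _ _)

lemma integral_log_add_prod {c d : ℝ} (hcd : c ≤ d) :
    ∫ z : ℝ × ℝ, Real.log (z.1 + z.2)
      ∂((volume.restrict (Set.Ioc c d)).prod (volume.restrict (Set.Ioc c d))) =
      2 * d ^ 2 * Real.log (2 * d) + 2 * c ^ 2 * Real.log (2 * c)
        - (c + d) ^ 2 * Real.log (c + d) - 3 / 2 * (d - c) ^ 2 := by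
  rw [integral_prod _ (integrable_log_add_prod hcd)]
  have hinner : ∀ x : ℝ, ∫ y in Set.Ioc c d, Real.log (x + y) =
      (x + d) * Real.log (x + d) - (x + c) * Real.log (x + c) - (d - c) := by
    intro x
    rw [← intervalIntegral.integral_of_le hcd,
      intervalIntegral.integral_comp_add_left (fun t => Real.log t) x, integral_log]
    ring
  simp only [hinner]
  rw [← intervalIntegral.integral_of_le hcd]
  have hi : ∀ e : ℝ, IntervalIntegrable (fun x => (x + e) * Real.log (x + e)) volume c d :=
    fun e => (Real.continuous_mul_log.comp
      (continuous_id.add continuous_const)).intervalIntegrable _ _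
  rw [intervalIntegral.integral_sub ((hi d).sub (hi c)) (by simp),
    intervalIntegral.integral_sub (hi d) (hi c),
    intervalIntegral.integral_comp_add_right (fun t => t * Real.log t),
    intervalIntegral.integral_comp_add_right (fun t => t * Real.log t),
    integral_mul_log, integral_mul_log, intervalIntegral.integral_const, add_comm d c,
    ← two_mul, ← two_mul, smul_eq_mul]
  ring

lemma integral_log_abs_one_add_div_prod {c d : ℝ} (hcd : c ≤ d) :
    ∫ z : ℝ × ℝ, Real.log |1 + z.2 / z.1|
      ∂((volume.restrict (Set.Ioc c d)).prod (volume.restrict (Set.Ioc c d))) =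
      2 * d ^ 2 * Real.log (2 * d) + 2 * c ^ 2 * Real.log (2 * c)
        - (c + d) ^ 2 * Real.log (c + d) - 3 / 2 * (d - c) ^ 2
        - (d - c) * (d * Real.log d - c * Real.log c - d + c) := by
  set ν := volume.restrict (Set.Ioc c d) with hν
  have hlog : Integrable Real.log ν :=
    (intervalIntegrable_iff_integrableOn_Ioc_of_le hcd).1
      intervalIntegral.intervalIntegrable_log'
  have hne : ∀ e : ℝ, ∀ᵐ y ∂ν, y ≠ e := fun e =>
    ae_restrict_of_ae (Measure.ae_ne volume e)
  have hae : ∀ᵐ z ∂(ν.prod ν), z.1 ≠ 0 ∧ z.1 + z.2 ≠ 0 := by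
    have hms : MeasurableSet {z : ℝ × ℝ | z.1 ≠ 0 ∧ z.1 + z.2 ≠ 0} := by
      refine MeasurableSet.inter ?_ ?_
      · exact (measurableSet_eq_fun measurable_fst measurable_const).compl
      · exact (measurableSet_eq_fun (measurable_fst.add measurable_snd) measurable_const).compl
    rw [Measure.ae_prod_iff_ae_ae hms]
    filter_upwards [hne 0] with x hx
    filter_upwards [hne (-x)] with y hy
    exact ⟨hx, fun h => hy (by linarith)⟩
  have hcongr : ∫ z : ℝ × ℝ, Real.log |1 + z.2 / z.1| ∂(ν.prod ν) =
      ∫ z : ℝ × ℝ, (Real.log (z.1 + z.2) - Real.log z.1) ∂(ν.prod ν) := by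
    refine integral_congr_ae ?_
    filter_upwards [hae] with z hz
    rw [Real.log_abs, ← Real.log_div hz.2 hz.1, add_div, div_self hz.1]
  have hfst : ∫ z : ℝ × ℝ, Real.log z.1 ∂(ν.prod ν) =
      (d - c) * (d * Real.log d - c * Real.log c - d + c) := by
    rw [integral_fun_fst, hν, ← intervalIntegral.integral_of_le hcd, integral_log]
    simp [measureReal_def, hcd]
  rw [hcongr, integral_sub (integrable_log_add_prod hcd) (hlog.comp_fst ν), hfst,
    integral_log_add_prod hcd]

/-- Example 5.2 (uniform, general case): for `0 < a`, `0 < b`, `a ≠ b`, and `x₁, x₂`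
i.i.d. uniform on `[-a, b]`,
`E[log|1 + x₂/x₁|] = 2 (a²+b²)/(a+b)² log 2 - 1/2
  + ((a-b)/(a+b)²) (b log|1 - a/b| - a log|1 - b/a|)`. -/
theorem uniform_general_lyapunov
    {Ω : Type*} [MeasurableSpace Ω] (P : Measure Ω) [IsProbabilityMeasure P]
    (a b : ℝ) (ha : 0 < a) (hb : 0 < b) (hab : a ≠ b)
    (x₁ x₂ : Ω → ℝ) (hm₁ : Measurable x₁) (hm₂ : Measurable x₂)
    (hindep : IndepFun x₁ x₂ P)
    (hd₁ : Measure.map x₁ P =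
      (ENNReal.ofReal (a + b))⁻¹ • volume.restrict (Set.Icc (-a) b))
    (hd₂ : Measure.map x₂ P = Measure.map x₁ P) :
    ∫ ω, Real.log |1 + x₂ ω / x₁ ω| ∂P =
      2 * ((a ^ 2 + b ^ 2) / (a + b) ^ 2) * Real.log 2 - 1 / 2
        + ((a - b) / (a + b) ^ 2) *
            (b * Real.log |1 - a / b| - a * Real.log |1 - b / a|) := by
  have hs : 0 < a + b := by linarith
  have hmap : Measure.map (fun ω => (x₁ ω, x₂ ω)) P =
      (Measure.map x₁ P).prod (Measure.map x₂ P) :=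
    (indepFun_iff_map_prod_eq_prod_map_map hm₁.aemeasurable hm₂.aemeasurable).1 hindep
  have hf : Measurable (fun z : ℝ × ℝ => Real.log |1 + z.2 / z.1|) :=
    Real.measurable_log.comp
      ((measurable_const.add (measurable_snd.div measurable_fst)).abs)
  have hpush : ∫ ω, Real.log |1 + x₂ ω / x₁ ω| ∂P =
      ∫ z : ℝ × ℝ, Real.log |1 + z.2 / z.1| ∂(Measure.map (fun ω => (x₁ ω, x₂ ω)) P) :=
    (integral_map (hm₁.prodMk hm₂).aemeasurable hf.aestronglyMeasurable).symm
  have hIcc : volume.restrict (Set.Icc (-a) b) = volume.restrict (Set.Ioc (-a) b) :=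
    (Measure.restrict_congr_set Ioc_ae_eq_Icc).symm
  rw [hpush, hmap, hd₂, hd₁, hIcc, Measure.prod_smul_left, Measure.prod_smul_right,
    integral_smul_measure, integral_smul_measure,
    integral_log_abs_one_add_div_prod (by linarith : -a ≤ b), ENNReal.toReal_inv,
    ENNReal.toReal_ofReal hs.le, smul_eq_mul, smul_eq_mul]
  have hba : b - a ≠ 0 := sub_ne_zero.2 hab.symm
  have e1 : Real.log |1 - a / b| = Real.log (b - a) - Real.log b := by
    rw [Real.log_abs, ← Real.log_div hba hb.ne', sub_div, div_self hb.ne']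
  have e2 : Real.log |1 - b / a| = Real.log (b - a) - Real.log a := by
    rw [Real.log_abs, ← Real.log_div hba ha.ne', ← Real.log_neg_eq_log, sub_div,
      div_self ha.ne', neg_sub]
  have e3 : Real.log (2 * -a) = Real.log 2 + Real.log a := by
    rw [mul_neg, Real.log_neg_eq_log, Real.log_mul two_ne_zero ha.ne']
  rw [e1, e2, e3, Real.log_mul two_ne_zero hb.ne', Real.log_neg_eq_log, neg_add_eq_sub]
  field_simp
  ring
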